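/- Let G be a group, H ≤ G a subgroup, and k an integer with k ≠ 1 and k ≠ -1. Then the amalgamated free product G ∗_H G (two copies of G amalgamated along the identity map of H) embeds into the quotient of the HNN extension G∗_H (along the identity of H, with stable letter t) by the normal closure of t^k. -/

import Mathlib

open Monoid in
theorem amalgam_aux (G : Type*) [Group G] (H : Subgroup G) (k : ℤ)
    (I : Type) [Group I] (τ : I) (hτ : τ ≠ 1) (hτk : τ ^ k = 1) :
    ∃ f : Monoid.PushoutI (fun _ : Bool => H.subtype) →*
        (HNNExtension G H H (MulEquiv.refl H) ⧸
          Subgroup.normalClosure {(HNNExtension.t : HNNExtension G H H (MulEquiv.refl H)) ^ k}),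
      Function.Injective f := by
  classical
  let φ : ∀ _ : Bool, H →* G := fun _ => H.subtype
  let P := PushoutI φ
  have hbase : ∀ (b : Bool) (h : H), (PushoutI.of (φ := φ) b (h : G)) = PushoutI.base φ h :=
    fun b h => PushoutI.of_apply_eq_base φ b h
  let c : I → Bool := fun i => decide (i = 1)
  let S := (I → P) ⋊[(mulAutArrow : I →* MulAut (I → P))] I
  let e : G →* (I → P) := MonoidHom.pi fun i => PushoutI.of (φ := φ) (c i)
  have hconj : ∀ g : G, (SemidirectProduct.inr τ : S) * SemidirectProduct.inl (e g) *
      (SemidirectProduct.inr τ : S)⁻¹ =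
      SemidirectProduct.inl (fun i => PushoutI.of (φ := φ) (c (τ⁻¹ * i)) g) := by
    intro g
    rw [← map_inv, ← SemidirectProduct.inl_aut]
    rfl
  let F₀ : HNNExtension G H H (MulEquiv.refl H) →* S :=
    HNNExtension.lift (SemidirectProduct.inl.comp e) (SemidirectProduct.inr τ) (by
      intro a
      rw [← mul_inv_eq_iff_eq_mul]
      refine (hconj a).trans ?_
      change _ = SemidirectProduct.inl (e a)
      congr 1
      funext i
      exact (hbase _ _).trans (hbase _ _).symm)
  let N := Subgroup.normalClosure
    {(HNNExtension.t : HNNExtension G H H (MulEquiv.refl H)) ^ k}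
  have hF₀ : N ≤ F₀.ker := by
    refine Subgroup.normalClosure_le_normal ?_
    rintro _ rfl
    change F₀ _ = 1
    rw [map_zpow, HNNExtension.lift_t, ← map_zpow, hτk, map_one]
  let F : (HNNExtension G H H (MulEquiv.refl H) ⧸ N) →* S := QuotientGroup.lift N F₀ hF₀
  let q := QuotientGroup.mk' N
  let u : G →* (HNNExtension G H H (MulEquiv.refl H) ⧸ N) := q.comp HNNExtension.of
  let v : G →* (HNNExtension G H H (MulEquiv.refl H) ⧸ N) :=
    (MulAut.conj (q HNNExtension.t)).toMonoidHom.comp u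
  let f : P →* (HNNExtension G H H (MulEquiv.refl H) ⧸ N) :=
    PushoutI.lift (fun b => if b then u else v) (u.comp H.subtype) (by
      intro b
      cases b
      · ext h
        change q HNNExtension.t * q (HNNExtension.of (h : G)) * (q HNNExtension.t)⁻¹ =
          q (HNNExtension.of (h : G))
        rw [← map_mul, HNNExtension.t_mul_of, map_mul, mul_inv_cancel_right]
        rfl
      · rfl)
  let y : I → (P →* P) := fun i =>
    PushoutI.lift (fun b => PushoutI.of (φ := φ) (if b then c i else c (τ⁻¹ * i)))
      (PushoutI.base φ) (fun b => PushoutI.of_comp_eq_base _)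
  let Y : P →* (I → P) := MonoidHom.pi y
  have hFf : F.comp f = SemidirectProduct.inl.comp Y := by
    refine PushoutI.hom_ext_nonempty ?_
    intro b
    ext1 g
    have hu : F (u g) = SemidirectProduct.inl (e g) := by
      change F₀ (HNNExtension.of g) = _
      exact HNNExtension.lift_of _ _ _ _
    have ht : F (q HNNExtension.t) = SemidirectProduct.inr τ := by
      change F₀ HNNExtension.t = _
      exact HNNExtension.lift_t _ _ _
    have hf : f (PushoutI.of b g) = (if b then u else v) g := PushoutI.lift_of _ _ _ _
    have hY : Y (PushoutI.of b g) =
        fun i => PushoutI.of (φ := φ) (if b then c i else c (τ⁻¹ * i)) g := by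
      funext i
      change y i (PushoutI.of b g) = _
      exact PushoutI.lift_of _ _ _ _
    change F (f (PushoutI.of b g)) = SemidirectProduct.inl (Y (PushoutI.of b g))
    rw [hf, hY]
    cases b
    · change F (q HNNExtension.t * u g * (q HNNExtension.t)⁻¹) = _
      rw [map_mul, map_mul, map_inv, hu, ht]
      exact hconj g
    · exact hu
  have hY1 : (Pi.evalMonoidHom (fun _ : I => P) 1).comp Y = MonoidHom.id P := by
    refine PushoutI.hom_ext_nonempty ?_
    intro b
    ext1 g
    have hy : y 1 (PushoutI.of b g) =
        PushoutI.of (φ := φ) (if b then c 1 else c (τ⁻¹ * 1)) g := PushoutI.lift_of _ _ _ _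
    refine Eq.trans hy ?_
    cases b <;> simp [c, hτ]
  refine ⟨f, (injective_iff_map_eq_one f).2 ?_⟩
  intro x hx
  have h1 : F (f x) = SemidirectProduct.inl (Y x) := DFunLike.congr_fun hFf x
  rw [hx, map_one] at h1
  have h2 : Y x = 1 := SemidirectProduct.inl_injective (h1.symm.trans (map_one _).symm)
  have h3 : Y x 1 = x := DFunLike.congr_fun hY1 x
  rw [← h3, h2]
  rfl


/-- Let `G` be a group, `H ≤ G` a subgroup and `k : ℤ` with `k ≠ 1`, `k ≠ -1`.
Then the amalgamated free product `G ∗_H G` (two copies of `G` amalgamated along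
the identity of `H`) embeds into the quotient of the HNN extension `G∗_H`
(along the identity of `H`, with stable letter `t`) by the normal closure of `t^k`. -/
theorem amalgam_embeds_in_hnn_quotient
    (G : Type*) [Group G] (H : Subgroup G) (k : ℤ) (hk1 : k ≠ 1) (hk2 : k ≠ -1) :
    ∃ f : Monoid.PushoutI (fun _ : Bool => H.subtype) →*
        (HNNExtension G H H (MulEquiv.refl H) ⧸
          Subgroup.normalClosure {(HNNExtension.t : HNNExtension G H H (MulEquiv.refl H)) ^ k}),
      Function.Injective f := by
  refine amalgam_aux G H k (Multiplicative (ZMod k.natAbs)) (Multiplicative.ofAdd 1) ?_ ?_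
  · intro h
    have h0 : ((1 : ℕ) : ZMod k.natAbs) = 0 := by
      rw [Nat.cast_one]
      exact Multiplicative.ofAdd.injective h
    rw [ZMod.natCast_eq_zero_iff] at h0
    have := Nat.dvd_one.1 h0
    omega
  · rw [← ofAdd_zsmul, zsmul_one]
    have : (k : ZMod k.natAbs) = 0 := by
      rw [CharP.intCast_eq_zero_iff (ZMod k.natAbs) k.natAbs]
      simp
    rw [this]
    rfl
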